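/- Let G be a group equipped with a right-invariant linear order <, and let T₁(G) be the single-label order-1 intersection-tree group, with (g,h) denoting the class of Y(∗,∗,∗;1,g,h). Then T₁(G) is the internal direct sum of a free abelian subgroup with basis { (a,b) : a,b ∈ G, 1 < a < b } and an elementary abelian 2-group with basis { (1,a) : a ∈ G, 1 ≤ a }. -/

import Mathlib

namespace Paper

variable (G : Type) [Group G] (ι : Type)

/-- Relator set for the order-1 intersection-tree group `T₁(G;ι)`:
(CYC) `Y(i,j,k;a,b,c) = Y(j,k,i;b,c,a)`;
(AS) `Y(i,j,k;a,b,c) = −Y(i,k,j;a,c,b)`;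
(HOL) `Y(i,j,k;a,b,c) = Y(i,j,k;ag,bg,cg)`;
(FR) `Y(i,j,i;a,b,a) = Y(i,j,j;a,b,b)`. -/
def T1Rels : Set (FreeAbelianGroup (ι × ι × ι × G × G × G)) :=
  { x | (∃ i j k a b c, x = FreeAbelianGroup.of (i,j,k,a,b,c) - FreeAbelianGroup.of (j,k,i,b,c,a))
      ∨ (∃ i j k a b c, x = FreeAbelianGroup.of (i,j,k,a,b,c) + FreeAbelianGroup.of (i,k,j,a,c,b))
      ∨ (∃ i j k a b c g, x = FreeAbelianGroup.of (i,j,k,a,b,c)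
            - FreeAbelianGroup.of (i,j,k,a*g,b*g,c*g))
      ∨ (∃ i j a b, x = FreeAbelianGroup.of (i,j,i,a,b,a) - FreeAbelianGroup.of (i,j,j,a,b,b)) }

/-- The order-1 intersection-tree group `T₁(G;ι)`. -/
abbrev T1 := FreeAbelianGroup (ι × ι × ι × G × G × G) ⧸ AddSubgroup.closure (T1Rels G ι)

/-- Class of the generator `Y(i,j,k;a,b,c)` in `T₁(G;ι)`. -/
def Y (i j k : ι) (a b c : G) : T1 G ι :=
  QuotientAddGroup.mk (FreeAbelianGroup.of (i,j,k,a,b,c))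

/-- The pair notation `(g,h) := Y(∗,∗,∗;1,g,h)` in the single-label group `T₁(G)`. -/
def pairY (g h : G) : T1 G Unit := Y G Unit () () () 1 g h

section Relations

variable {G ι}

theorem Y_cyc (i j k : ι) (a b c : G) : Y G ι i j k a b c = Y G ι j k i b c a := by
  refine sub_eq_zero.1 ((QuotientAddGroup.eq_zero_iff
    (FreeAbelianGroup.of (i, j, k, a, b, c) - FreeAbelianGroup.of (j, k, i, b, c, a))).2 ?_)
  exact AddSubgroup.subset_closure (Or.inl ⟨i, j, k, a, b, c, rfl⟩)

theorem Y_antisymm (i j k : ι) (a b c : G) : Y G ι i j k a b c = -Y G ι i k j a c b := by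
  refine eq_neg_of_add_eq_zero_left ((QuotientAddGroup.eq_zero_iff
    (FreeAbelianGroup.of (i, j, k, a, b, c) + FreeAbelianGroup.of (i, k, j, a, c, b))).2 ?_)
  exact AddSubgroup.subset_closure (Or.inr (Or.inl ⟨i, j, k, a, b, c, rfl⟩))

theorem Y_mul_right (i j k : ι) (a b c g : G) :
    Y G ι i j k (a * g) (b * g) (c * g) = Y G ι i j k a b c := by
  refine (sub_eq_zero.1 ((QuotientAddGroup.eq_zero_iff
    (FreeAbelianGroup.of (i, j, k, a, b, c) -
      FreeAbelianGroup.of (i, j, k, a * g, b * g, c * g))).2 ?_)).symm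
  exact AddSubgroup.subset_closure (Or.inr (Or.inr (Or.inl ⟨i, j, k, a, b, c, g, rfl⟩)))

theorem Y_framing (i j : ι) (a b : G) : Y G ι i j i a b a = Y G ι i j j a b b := by
  refine sub_eq_zero.1 ((QuotientAddGroup.eq_zero_iff
    (FreeAbelianGroup.of (i, j, i, a, b, a) - FreeAbelianGroup.of (i, j, j, a, b, b))).2 ?_)
  exact AddSubgroup.subset_closure (Or.inr (Or.inr (Or.inr ⟨i, j, a, b, rfl⟩)))

theorem pairY_mul_inv (a b c : G) :
    pairY G (b * a⁻¹) (c * a⁻¹) = Y G Unit () () () a b c := by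
  rw [← Y_mul_right () () () a b c a⁻¹, mul_inv_cancel, pairY]

theorem pairY_one_add_self (a : G) : pairY G 1 a + pairY G 1 a = 0 := by
  have h : pairY G 1 a = Y G Unit () () () a 1 1 := by rw [pairY, Y_cyc, Y_cyc]
  rw [h]
  exact eq_neg_iff_add_eq_zero.1 (Y_antisymm () () () a 1 1)

/-- The homomorphism from `ℤ/2` sending `1` to the 2-torsion class `(1,a)`. -/
noncomputable def torsionHom (a : G) : ZMod 2 →+ T1 G Unit :=
  ZMod.lift 2 ⟨zmultiplesHom _ (pairY G 1 a), (two_zsmul _).trans (pairY_one_add_self a)⟩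

theorem torsionHom_one (a : G) : torsionHom a 1 = pairY G 1 a := by
  rw [torsionHom, ← Int.cast_one, ZMod.lift_coe]
  exact one_zsmul _

end Relations

section NormalForm

variable [LinearOrder G]

/-- The free summand of the normal form. -/
abbrev FreePart := DirectSum {p : G × G // 1 < p.1 ∧ p.1 < p.2} (fun _ => ℤ)

/-- The 2-torsion summand of the normal form. -/
abbrev TorsionPart := DirectSum {a : G // 1 ≤ a} (fun _ => ZMod 2)

/-- The homomorphism sending the basis elements of the normal form to their trees. -/
noncomputable def ofNormalForm : FreePart G × TorsionPart G →+ T1 G Unit :=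
  (DirectSum.toAddMonoid fun p : {p : G × G // 1 < p.1 ∧ p.1 < p.2} =>
    zmultiplesHom _ (pairY G p.val.1 p.val.2)).coprod
  (DirectSum.toAddMonoid fun a : {a : G // 1 ≤ a} => torsionHom a.val)

variable {G}

theorem ofNormalForm_free (p : {p : G × G // 1 < p.1 ∧ p.1 < p.2}) :
    ofNormalForm G (DirectSum.of (fun _ => ℤ) p 1, 0) = pairY G p.val.1 p.val.2 := by
  simp [ofNormalForm]

theorem ofNormalForm_torsion (a : {a : G // 1 ≤ a}) :
    ofNormalForm G (0, DirectSum.of (fun _ => ZMod 2) a 1) = pairY G 1 a.val := by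
  simp [ofNormalForm, torsionHom_one]

theorem torsionPart_neg (x : TorsionPart G) : -x = x := by
  refine DFinsupp.ext fun i => ?_
  exact ZMod.neg_eq_self_mod_two (x i)

section RightInvariant

variable [MulRightStrictMono G]

theorem one_lt_mul_inv_and_lt {a b c : G} (h : a < b ∧ b < c) :
    1 < b * a⁻¹ ∧ b * a⁻¹ < c * a⁻¹ := by
  rw [← mul_inv_cancel a]
  exact ⟨mul_lt_mul_left h.1 _, mul_lt_mul_left h.2 _⟩

/-- The basis element of an increasing triple, and zero on every other triple. -/
noncomputable def increasingClass (a b c : G) : FreePart G :=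
  if h : a < b ∧ b < c then
    DirectSum.of (fun _ => ℤ) ⟨(b * a⁻¹, c * a⁻¹), one_lt_mul_inv_and_lt h⟩ 1
  else 0

theorem increasingClass_mul_right (a b c g : G) :
    increasingClass (a * g) (b * g) (c * g) = increasingClass a b c := by
  simp [increasingClass]

/-- The alternating extension of `increasingClass` to all triples. -/
noncomputable def freeClass (a b c : G) : FreePart G :=
  increasingClass a b c + increasingClass b c a + increasingClass c a b
    - increasingClass a c b - increasingClass c b a - increasingClass b a c

theorem one_le_max_mul_inv_min (a b : G) : 1 ≤ max a b * (min a b)⁻¹ := by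
  have := mulRightMono_of_mulRightStrictMono G
  rw [← mul_inv_cancel (min a b)]
  exact mul_le_mul_left min_le_max _

/-- The torsion basis element of an unordered pair. -/
noncomputable def pairClass (a b : G) : TorsionPart G :=
  DirectSum.of (fun _ => ZMod 2) ⟨max a b * (min a b)⁻¹, one_le_max_mul_inv_min a b⟩ 1

theorem pairClass_comm (a b : G) : pairClass a b = pairClass b a := by
  simp only [pairClass, max_comm, min_comm]

theorem pairClass_mul_right (a b g : G) : pairClass (a * g) (b * g) = pairClass a b := by
  have := mulRightMono_of_mulRightStrictMono G
  simp only [pairClass, max_mul_mul_right, min_mul_mul_right, mul_inv_rev, mul_assoc,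
    mul_inv_cancel_left]

/-- The torsion class of a triple with a repeated entry, and zero on every other triple. -/
noncomputable def torsionClass (a b c : G) : TorsionPart G :=
  if a = b then pairClass a c
  else if b = c then pairClass a b
  else if a = c then pairClass a b
  else 0

theorem torsionClass_cyc (a b c : G) : torsionClass a b c = torsionClass b c a := by
  grind [torsionClass, pairClass_comm]

theorem torsionClass_swap (a b c : G) : torsionClass a b c = torsionClass a c b := by
  grind [torsionClass, pairClass_comm]

theorem torsionClass_mul_right (a b c g : G) :
    torsionClass (a * g) (b * g) (c * g) = torsionClass a b c := by
  simp [torsionClass, pairClass_mul_right]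

theorem torsionClass_framing (a b : G) : torsionClass a b a = torsionClass a b b := by
  grind [torsionClass]

/-- The normal form of the tree with edge decorations `a`, `b`, `c`. -/
noncomputable def treeNormalForm (x : Unit × Unit × Unit × G × G × G) :
    FreePart G × TorsionPart G :=
  (freeClass x.2.2.2.1 x.2.2.2.2.1 x.2.2.2.2.2, torsionClass x.2.2.2.1 x.2.2.2.2.1 x.2.2.2.2.2)

theorem closure_T1Rels_le_ker :
    AddSubgroup.closure (T1Rels G Unit) ≤ (FreeAbelianGroup.lift (treeNormalForm (G := G))).ker := by
  rw [AddSubgroup.closure_le]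
  rintro x (⟨i, j, k, a, b, c, rfl⟩ | ⟨i, j, k, a, b, c, rfl⟩ | ⟨i, j, k, a, b, c, g, rfl⟩ |
    ⟨i, j, a, b, rfl⟩) <;>
    simp only [SetLike.mem_coe, AddMonoidHom.mem_ker, map_sub, map_add,
      FreeAbelianGroup.lift_apply_of, treeNormalForm, Prod.mk_sub_mk, Prod.mk_add_mk,
      Prod.mk_eq_zero]
  · exact ⟨by simp only [freeClass]; abel, sub_eq_zero.2 (torsionClass_cyc a b c)⟩
  · refine ⟨by simp only [freeClass]; abel, ?_⟩
    rw [← eq_neg_iff_add_eq_zero, torsionPart_neg, torsionClass_swap]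
  · simp only [freeClass, increasingClass_mul_right, torsionClass_mul_right, sub_self, and_self]
  · refine ⟨?_, sub_eq_zero.2 (torsionClass_framing a b)⟩
    simp only [freeClass]
    abel_nf

/-- The homomorphism sending a tree to its normal form. -/
noncomputable def toNormalForm : T1 G Unit →+ FreePart G × TorsionPart G :=
  QuotientAddGroup.lift _ (FreeAbelianGroup.lift treeNormalForm) closure_T1Rels_le_ker

theorem toNormalForm_Y (a b c : G) :
    toNormalForm (Y G Unit () () () a b c) = (freeClass a b c, torsionClass a b c) := by
  simp [toNormalForm, Y, treeNormalForm]

theorem toNormalForm_pairY_free (p : {p : G × G // 1 < p.1 ∧ p.1 < p.2}) :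
    toNormalForm (pairY G p.val.1 p.val.2) = (DirectSum.of (fun _ => ℤ) p 1, 0) := by
  obtain ⟨⟨a, b⟩, h₁, h₂⟩ := p
  simp only at h₁ h₂
  have h₃ := h₁.trans h₂
  rw [pairY, toNormalForm_Y]
  simp [freeClass, torsionClass, increasingClass, h₁, h₂, h₃, h₁.not_gt, h₂.not_gt, h₃.not_gt,
    h₁.ne, h₂.ne, h₃.ne]

theorem toNormalForm_pairY_torsion (a : {a : G // 1 ≤ a}) :
    toNormalForm (pairY G 1 a.val) = (0, DirectSum.of (fun _ => ZMod 2) a 1) := by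
  obtain ⟨a, h⟩ := a
  rw [pairY, toNormalForm_Y]
  simp [freeClass, torsionClass, increasingClass, pairClass, h, h.not_gt]

theorem ofNormalForm_increasingClass (a b c : G) :
    ofNormalForm G (increasingClass a b c, 0) =
      if a < b ∧ b < c then Y G Unit () () () a b c else 0 := by
  by_cases h : a < b ∧ b < c
  · rw [increasingClass, dif_pos h, if_pos h, ofNormalForm_free, pairY_mul_inv]
  · rw [increasingClass, dif_neg h, if_neg h, Prod.mk_zero_zero, map_zero]

theorem ofNormalForm_pairClass (a b : G) :
    ofNormalForm G (0, pairClass a b) = Y G Unit () () () a b b := by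
  have key (a b : G) (h : a ≤ b) :
      ofNormalForm G (0, pairClass a b) = Y G Unit () () () a b b := by
    rw [pairClass, ofNormalForm_torsion, ← Y_framing, ← Y_cyc]
    simp only [max_eq_right h, min_eq_left h]
    rw [← mul_inv_cancel a, pairY_mul_inv]
  rcases le_total a b with h | h
  · exact key a b h
  · rw [pairClass_comm, key b a h, ← Y_framing, Y_cyc]

theorem ofNormalForm_freeClass (a b c : G) (hab : a ≠ b) (hbc : b ≠ c) (hac : a ≠ c) :
    ofNormalForm G (freeClass a b c, 0) = Y G Unit () () () a b c := by
  have split : ofNormalForm G (freeClass a b c, 0) =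
      ofNormalForm G (increasingClass a b c, 0) + ofNormalForm G (increasingClass b c a, 0)
      + ofNormalForm G (increasingClass c a b, 0) - ofNormalForm G (increasingClass a c b, 0)
      - ofNormalForm G (increasingClass c b a, 0) - ofNormalForm G (increasingClass b a c, 0) := by
    simp only [← map_add, ← map_sub, Prod.mk_add_mk, Prod.mk_sub_mk, add_zero, sub_zero, freeClass]
  have e₁ := Y_cyc () () () a b c
  have e₂ := Y_cyc () () () c a b
  have e₃ := Y_antisymm () () () a b c
  have e₄ := Y_antisymm () () () b c a
  have e₅ := Y_antisymm () () () c a b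
  rw [split]
  simp only [ofNormalForm_increasingClass]
  rcases hab.lt_or_gt with h₁ | h₁ <;> rcases hbc.lt_or_gt with h₂ | h₂ <;>
    rcases hac.lt_or_gt with h₃ | h₃ <;>
    first
    | exact absurd (h₁.trans h₂) h₃.not_gt
    | simp [h₁, h₂, h₃, h₁.not_gt, h₂.not_gt, h₃.not_gt] <;> grind

theorem freeClass_eq_zero {a b c : G} (h : a = b ∨ b = c ∨ a = c) : freeClass a b c = 0 := by
  rcases h with rfl | rfl | rfl <;> simp only [freeClass] <;> abel

theorem ofNormalForm_toNormalForm_Y (a b c : G) :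
    ofNormalForm G (toNormalForm (Y G Unit () () () a b c)) = Y G Unit () () () a b c := by
  rw [toNormalForm_Y]
  by_cases h : a = b ∨ b = c ∨ a = c
  · rw [freeClass_eq_zero h, torsionClass]
    split_ifs with hab hbc hac
    · subst hab
      rw [ofNormalForm_pairClass, ← Y_framing, ← Y_cyc]
    · subst hbc
      rw [ofNormalForm_pairClass]
    · subst hac
      rw [ofNormalForm_pairClass, ← Y_framing]
    · tauto
  · simp only [not_or] at h
    rw [torsionClass, if_neg h.1, if_neg h.2.1, if_neg h.2.2]
    exact ofNormalForm_freeClass a b c h.1 h.2.1 h.2.2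

theorem ofNormalForm_comp_toNormalForm :
    (ofNormalForm G).comp toNormalForm = AddMonoidHom.id (T1 G Unit) := by
  refine QuotientAddGroup.addMonoidHom_ext _ (FreeAbelianGroup.lift_ext _ _ ?_)
  rintro ⟨⟨⟩, ⟨⟩, ⟨⟩, a, b, c⟩
  exact ofNormalForm_toNormalForm_Y a b c

theorem toNormalForm_comp_ofNormalForm :
    toNormalForm.comp (ofNormalForm G) = AddMonoidHom.id (FreePart G × TorsionPart G) := by
  rw [← AddMonoidHom.coprod_unique (toNormalForm.comp (ofNormalForm G)),
    ← AddMonoidHom.coprod_inl_inr]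
  congr 1 <;> refine DirectSum.addHom_ext' fun p => ?_
  · refine AddMonoidHom.ext_int ?_
    exact (congrArg toNormalForm (ofNormalForm_free p)).trans (toNormalForm_pairY_free p)
  · refine (ZMod.lift 2).symm.injective (Subtype.ext (AddMonoidHom.ext_int ?_))
    exact (congrArg toNormalForm (ofNormalForm_torsion p)).trans (toNormalForm_pairY_torsion p)

end RightInvariant

end NormalForm

/-- for `G` with a right-invariant linear order, `T₁(G)` is the internal
direct sum of the free abelian group on the basis `{(a,b) : 1 < a < b}` and the
elementary abelian 2-group on the basis `{(1,a) : 1 ≤ a}`. -/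
theorem T1_orderable_normal_form (G : Type) [Group G] [LinearOrder G]
    (hro : ∀ f g h : G, g < h → g * f < h * f) :
    ∃ e : (DirectSum {p : G × G // 1 < p.1 ∧ p.1 < p.2} (fun _ => ℤ) ×
            DirectSum {a : G // 1 ≤ a} (fun _ => ZMod 2)) ≃+ T1 G Unit,
      (∀ b : {p : G × G // 1 < p.1 ∧ p.1 < p.2},
        e (DirectSum.of (fun _ => ℤ) b 1, 0) = pairY G b.val.1 b.val.2) ∧
      (∀ b : {a : G // 1 ≤ a},
        e (0, DirectSum.of (fun _ => ZMod 2) b 1) = pairY G 1 b.val) := by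
  have : MulRightStrictMono G := ⟨fun f g h => hro f g h⟩
  exact ⟨AddMonoidHom.toAddEquiv (ofNormalForm G) toNormalForm toNormalForm_comp_ofNormalForm
    ofNormalForm_comp_toNormalForm, ofNormalForm_free, ofNormalForm_torsion⟩

end Paper
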